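/- arXiv:1412.6860 — 4 statements merged into one kernel-verified Lean document; each statement's English description precedes it below -/
import Mathlib

section
/- Let L : (0,∞) → (0,∞) be a measurable function that is slowly varying at infinity, let q > 0 and ν ∈ ℝ. Suppose there exist constants C > 0 and r₁ > 0 such that |1 − L(t·r)/L(r)| ≤ C·t^ν / r^q for all t ≥ 1 and all r ≥ r₁. Then there exist constants C' > 0 and r₂ > 0 such that |1 − L(t·r)/L(r)| ≤ C' / r^q for all t ≥ 1 and all r ≥ r₂ (i.e., the t-dependence in the remainder bound can be removed). -/
open Filter

/-- If a measurable, positive, slowly varying (at infinity) function `L`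
satisfies `|1 - L(t r)/L r| ≤ C t^ν / r^q` for all `t ≥ 1` and large `r`, then the
`t`-dependence can be removed: `|1 - L(t r)/L r| ≤ C' / r^q` for all `t ≥ 1` and large `r`. -/
theorem slowly_varying_remainder_uniform
    (L : ℝ → ℝ) (hLmeas : Measurable L) (hLpos : ∀ x > 0, 0 < L x)
    (hSV : ∀ t > 0, Tendsto (fun r : ℝ => L (r * t) / L r) atTop (nhds 1))
    (q ν C r₁ : ℝ) (hq : 0 < q) (hC : 0 < C) (hr₁ : 0 < r₁)
    (hbound : ∀ t ≥ (1 : ℝ), ∀ r ≥ r₁, |1 - L (t * r) / L r| ≤ C * t ^ ν / r ^ q) :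
    ∃ C' > (0 : ℝ), ∃ r₂ > (0 : ℝ), ∀ t ≥ (1 : ℝ), ∀ r ≥ r₂,
      |1 - L (t * r) / L r| ≤ C' / r ^ q := by
  set K : ℝ := C * 2 ^ |ν| with hK
  have hKpos : 0 < K := by positivity
  have hdyadic : ∀ t : ℝ, 1 ≤ t → t ≤ 2 → ∀ r ≥ r₁, |1 - L (t * r) / L r| ≤ K / r ^ q := by
    intro t h1 h2 r hr
    have hr0 : 0 < r := hr₁.trans_le hr
    refine (hbound t h1 r hr).trans ?_
    have hpow : t ^ ν ≤ 2 ^ |ν| :=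
      (Real.rpow_le_rpow_of_exponent_le h1 (le_abs_self ν)).trans
        (Real.rpow_le_rpow (by linarith) h2 (abs_nonneg ν))
    rw [hK]
    gcongr
  set B : ℝ := 2 ^ q with hB
  have hB1 : 1 < B := Real.one_lt_rpow one_lt_two hq
  set M : ℝ := 2 * K * B / (B - 1) with hM
  have hB0 : 0 < B - 1 := sub_pos.mpr hB1
  have hMpos : 0 < M := by positivity
  have hMB : M * (B - 1) = 2 * K * B := by
    rw [hM]
    field_simp
  have hKM : K ≤ M := by nlinarith
  obtain ⟨R, hR⟩ := eventually_atTop.mp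
    ((tendsto_rpow_atTop hq).eventually_ge_atTop (2 * K / (B - 1)))
  have hdouble : ∀ n : ℕ, ∀ t : ℝ, 1 ≤ t → t ≤ 2 ^ n → ∀ r ≥ max r₁ R,
      |1 - L (t * r) / L r| ≤ M / r ^ q := by
    intro n
    induction n with
    | zero =>
      intro t h1 h2 r hr
      have hr0 : 0 < r := hr₁.trans_le ((le_max_left _ _).trans hr)
      obtain rfl : t = 1 := le_antisymm (by simpa using h2) h1
      rw [one_mul, div_self (hLpos r hr0).ne']
      simp only [sub_self, abs_zero]
      positivity
    | succ n ih =>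
      intro t h1 h2 r hr
      have hr1 : r₁ ≤ r := (le_max_left _ _).trans hr
      have hr0 : 0 < r := hr₁.trans_le hr1
      have hrq : 0 < r ^ q := by positivity
      rcases le_total t 2 with ht | ht
      · exact (hdyadic t h1 ht r hr1).trans (by gcongr)
      have hs := ih (t / 2) (by linarith) (by rw [pow_succ] at h2; linarith) (2 * r)
        (by linarith)
      have htwo := hdyadic 2 one_le_two le_rfl r hr1
      rw [show t / 2 * (2 * r) = t * r by ring, Real.mul_rpow zero_le_two hr0.le] at hs
      have hsplit : L (t * r) / L r = L (t * r) / L (2 * r) * (L (2 * r) / L r) :=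
        (div_mul_div_cancel₀ (hLpos (2 * r) (by positivity)).ne').symm
      rw [hsplit]
      set u := L (t * r) / L (2 * r)
      set v := L (2 * r) / L r
      have hlarge : 2 * K ≤ r ^ q * (B - 1) :=
        (div_le_iff₀ hB0).mp (hR r ((le_max_right _ _).trans hr))
      calc |1 - u * v| = |(1 - u) + (1 - v) - (1 - u) * (1 - v)| := by congr 1; ring
        _ ≤ |1 - u| + |1 - v| + |1 - u| * |1 - v| := by
          rw [← abs_mul]
          exact (abs_sub _ _).trans (by gcongr; exact abs_add_le _ _)
        _ ≤ M / (B * r ^ q) + K / r ^ q + M / (B * r ^ q) * (K / r ^ q) := by gcongr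
        _ ≤ M / r ^ q := by
          have hKB : K = M * (B - 1) / (2 * B) := by rw [hMB]; field_simp
          have hsmall : K / r ^ q ≤ (B - 1) / 2 := by
            rw [div_le_iff₀ hrq]; linarith
          calc M / (B * r ^ q) + K / r ^ q + M / (B * r ^ q) * (K / r ^ q)
              ≤ M / (B * r ^ q) + K / r ^ q + M / (B * r ^ q) * ((B - 1) / 2) := by gcongr
            _ = M / r ^ q := by rw [hKB]; field_simp; ring
  refine ⟨M, hMpos, max r₁ R, hr₁.trans_le (le_max_left _ _), fun t ht r hr => ?_⟩
  obtain ⟨n, hn⟩ := pow_unbounded_of_one_lt t one_lt_two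
  exact hdouble n t ht hn.le r hr
end

section
/- Let q > 0 and let L : (0,∞) → (0,∞) be a differentiable function that is slowly varying at infinity and whose derivative satisfies |L'(r)| ≤ C₀·L(r)/r^{1+q} for all r ≥ r₀, for some constants C₀ > 0 and r₀ > 0. Then for every δ > 0 there exist constants C > 0 and r₁ > 0 such that |1 − L(t·r)/L(r)| ≤ C·t^{1+δ} / r^q for all t ≥ 1 and all r ≥ r₁. -/
open Filter

/-- A function whose derivative is at most `c / x ^ (1 + q)` beyond `r₀ > 0` increases by at most
`c / q / r ^ q` on `[r, s]` for `r₀ ≤ r ≤ s`. -/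
lemma sub_le_div_rpow_of_deriv_le {q c r₀ : ℝ} (hq : 0 < q) (hc : 0 ≤ c) (hr₀ : 0 < r₀)
    {f f' : ℝ → ℝ} (hf : ∀ x ≥ r₀, HasDerivAt f (f' x) x)
    (hf' : ∀ x ≥ r₀, f' x ≤ c / x ^ (1 + q)) {r s : ℝ} (hr : r₀ ≤ r) (hrs : r ≤ s) :
    f s - f r ≤ c / q / r ^ q := by
  have hder : ∀ x ≥ r₀, HasDerivAt (fun x => f x + c / q * x ^ (-q))
      (f' x + c / q * (-q * x ^ (-q - 1))) x := fun x hx =>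
    (hf x hx).add ((Real.hasDerivAt_rpow_const (Or.inl (hr₀.trans_le hx).ne')).const_mul _)
  have hanti : AntitoneOn (fun x => f x + c / q * x ^ (-q)) (Set.Ici r₀) := by
    refine antitoneOn_of_deriv_nonpos (convex_Ici _)
      (fun x hx => (hder x hx).continuousAt.continuousWithinAt)
      (fun x hx => (hder x (interior_subset hx)).differentiableAt.differentiableWithinAt) ?_
    intro x hx
    have hx' : r₀ ≤ x := interior_subset hx
    rw [(hder x hx').deriv]
    have h := hf' x hx'
    have hpow : x ^ (-q - 1) = (x ^ (1 + q))⁻¹ := by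
      rw [← Real.rpow_neg (hr₀.trans_le hx').le]
      ring_nf
    have hmul : c / q * (-q * x ^ (-q - 1)) = -(c / x ^ (1 + q)) := by
      rw [hpow]
      field_simp
    linarith
  have h := hanti (Set.mem_Ici.2 hr) (Set.mem_Ici.2 (hr.trans hrs)) hrs
  have hs : 0 ≤ c / q * s ^ (-q) :=
    mul_nonneg (by positivity) (Real.rpow_nonneg (hr₀.le.trans (hr.trans hrs)) _)
  simp only [Real.rpow_neg (hr₀.le.trans hr), ← div_eq_mul_inv] at h
  linarith

/-- If `L` is positive, differentiable, slowly varying at infinity, and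
`|L'(r)| ≤ C₀ L(r) / r^{1+q}` for large `r`, then for every `δ > 0` there are `C > 0`,
`r₁ > 0` with `|1 - L(t r)/L r| ≤ C t^{1+δ} / r^q` for all `t ≥ 1`, `r ≥ r₁`. -/
theorem slowly_varying_derivative_remainder
    (q : ℝ) (hq : 0 < q) (L L' : ℝ → ℝ)
    (hLpos : ∀ x > 0, 0 < L x)
    (hderiv : ∀ r > (0 : ℝ), HasDerivAt L (L' r) r)
    (hSV : ∀ t > 0, Tendsto (fun r : ℝ => L (r * t) / L r) atTop (nhds 1))
    (C₀ r₀ : ℝ) (hC₀ : 0 < C₀) (hr₀ : 0 < r₀)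
    (hbound : ∀ r ≥ r₀, |L' r| ≤ C₀ * L r / r ^ (1 + q)) :
    ∀ δ > (0 : ℝ), ∃ C > (0 : ℝ), ∃ r₁ > (0 : ℝ), ∀ t ≥ (1 : ℝ), ∀ r ≥ r₁,
      |1 - L (t * r) / L r| ≤ C * t ^ (1 + δ) / r ^ q := by
  intro δ hδ
  obtain ⟨R, hR⟩ := eventually_atTop.1 ((tendsto_rpow_atTop hq).eventually_ge_atTop (C₀ / q))
  refine ⟨2 * (C₀ / q), by positivity, max r₀ R, lt_max_of_lt_left hr₀, fun t ht r hr => ?_⟩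
  have hr0 : r₀ ≤ r := (le_max_left _ _).trans hr
  have hrpos : 0 < r := hr₀.trans_le hr0
  have htr : r ≤ t * r := le_mul_of_one_le_left hrpos.le ht
  have hrq : 0 < r ^ q := Real.rpow_pos_of_pos hrpos q
  have hlog : ∀ x ≥ r₀, HasDerivAt (fun x => Real.log (L x)) (L' x / L x) x := fun x hx =>
    (hderiv x (hr₀.trans_le hx)).log (hLpos x (hr₀.trans_le hx)).ne'
  have hlog' : ∀ x ≥ r₀, |L' x / L x| ≤ C₀ / x ^ (1 + q) := by
    intro x hx
    have hLx := hLpos x (hr₀.trans_le hx)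
    rw [abs_div, abs_of_pos hLx, div_le_iff₀ hLx, div_mul_eq_mul_div]
    exact hbound x hx
  have hupper := sub_le_div_rpow_of_deriv_le hq hC₀.le hr₀ hlog
    (fun x hx => (le_abs_self _).trans (hlog' x hx)) hr0 htr
  have hlower := sub_le_div_rpow_of_deriv_le hq hC₀.le hr₀ (fun x hx => (hlog x hx).neg)
    (fun x hx => (neg_le_abs _).trans (hlog' x hx)) hr0 htr
  have habs : |Real.log (L (t * r)) - Real.log (L r)| ≤ C₀ / q / r ^ q := by
    rw [abs_le]
    simp only [Pi.neg_apply] at hlower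
    constructor <;> linarith
  have hexp : L (t * r) / L r = Real.exp (Real.log (L (t * r)) - Real.log (L r)) := by
    rw [Real.exp_sub, Real.exp_log (hLpos _ (hrpos.trans_le htr)), Real.exp_log (hLpos _ hrpos)]
  have hsmall : C₀ / q / r ^ q ≤ 1 := (div_le_one hrq).2 (hR r ((le_max_right _ _).trans hr))
  calc |1 - L (t * r) / L r|
      ≤ 2 * |Real.log (L (t * r)) - Real.log (L r)| := by
        rw [abs_sub_comm, hexp]
        exact Real.abs_exp_sub_one_le (habs.trans hsmall)
    _ ≤ 2 * (C₀ / q) * 1 / r ^ q := by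
        rw [mul_one, mul_div_assoc]
        gcongr
    _ ≤ 2 * (C₀ / q) * t ^ (1 + δ) / r ^ q := by
        gcongr
        exact Real.one_le_rpow ht (by linarith)
end

section
/- Let d ≥ 1 and 0 < α < d/2. Let Δ ⊂ ℝ^d be a bounded convex set of positive Lebesgue measure containing the origin in its interior, and for r > 0 let Δ(r) := {r·x : x ∈ Δ} be its homothetic image. Let L : (0,∞) → (0,∞) be a measurable, locally bounded function, slowly varying at infinity, and satisfying L(u) ≤ u^α for all u > 0. Then for every δ > 0 there exist constants C > 0 and r₀ > 0 such that for all r ≥ r₀, ∫_{Δ(r)} ∫_{Δ(r)} ‖x − y‖^{−3α} · L(‖x − y‖)³ dx dy ≤ C · r^{2(d − α)} · L(r)² · r^{−α(d − 2α)/(d − α) + δ}. -/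
open MeasureTheory ENNReal Filter Pointwise

/-- A measurable function whose increments over every fixed distance vanish at infinity has
eventually bounded increments, uniformly over distances in `[0, 1]`. -/
lemma eventually_forall_abs_add_sub_le_two {h : ℝ → ℝ} (hm : Measurable h)
    (hlim : ∀ u, Tendsto (fun x => h (x + u) - h x) atTop (nhds 0)) :
    ∀ᶠ x in atTop, ∀ u ∈ Set.Icc (0 : ℝ) 1, |h (x + u) - h x| ≤ 2 := by
  set B : ℝ → Set ℝ := fun x => {u | u ∈ Set.Icc (0 : ℝ) 2 ∧ 1 < |h (x + u) - h x|} with hB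
  have hBm : ∀ x, MeasurableSet (B x) := fun x =>
    have habs : Measurable fun u => |h (x + u) - h x| := by fun_prop
    measurableSet_Icc.inter (measurableSet_lt measurable_const habs)
  have hBlim : Tendsto (fun x => volume (B x)) atTop (nhds (volume (∅ : Set ℝ))) := by
    refine tendsto_measure_of_tendsto_indicator atTop hBm (B := Set.Icc 0 2) measurableSet_Icc
      (by simp) (Eventually.of_forall fun x u hu => hu.1) fun u => ?_
    have h1 := (hlim u).abs.eventually (gt_mem_nhds (by simp : |(0 : ℝ)| < 1))
    filter_upwards [h1] with x hx
    simp only [hB, Set.mem_ofPred_eq, Set.mem_empty_iff_false, iff_false, not_and, not_lt]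
    exact fun _ => hx.le
  rw [measure_empty] at hBlim
  have hsmall := hBlim.eventually (gt_mem_nhds (by simp : (0 : ℝ≥0∞) < 2⁻¹))
  obtain ⟨X, hX⟩ := eventually_atTop.1 hsmall
  filter_upwards [eventually_ge_atTop X] with x hx u hu
  obtain ⟨v, hv, hv1, hv2⟩ : ∃ v ∈ Set.Icc (1 : ℝ) 2, v ∉ B x ∧ v - u ∉ B (x + u) := by
    by_contra! hcon
    have hsub : Set.Icc (1 : ℝ) 2 ⊆ B x ∪ (fun v => v - u) ⁻¹' B (x + u) := by
      intro v hv
      by_cases h1 : v ∈ B x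
      · exact Or.inl h1
      · exact Or.inr (hcon v hv h1)
    have hle := (measure_mono (μ := volume) hsub).trans (measure_union_le _ _)
    simp_rw [sub_eq_add_neg, measure_preimage_add_right] at hle
    have hlt := ENNReal.add_lt_add (hX x hx) (hX (x + u) (by linarith [hu.1]))
    rw [ENNReal.inv_two_add_inv_two] at hlt
    have hlt' := hle.trans_lt hlt
    norm_num [Real.volume_Icc] at hlt'
  have h1 : |h (x + v) - h x| ≤ 1 := by
    by_contra! hc
    exact hv1 ⟨⟨by linarith [hv.1], hv.2⟩, hc⟩
  have h2 : |h (x + v) - h (x + u)| ≤ 1 := by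
    by_contra! hc
    refine hv2 ⟨⟨by linarith [hv.1, hu.2], by linarith [hv.2, hu.1]⟩, ?_⟩
    rwa [show x + u + (v - u) = x + v by ring]
  rw [abs_le] at *
  constructor <;> linarith [h1.1, h1.2, h2.1, h2.2]

/-- A measurable function whose increments over every fixed distance vanish at infinity grows
sublinearly. -/
lemma eventually_abs_le_mul_of_tendsto_add_sub {h : ℝ → ℝ} (hm : Measurable h)
    (hlim : ∀ u, Tendsto (fun x => h (x + u) - h x) atTop (nhds 0)) {ε : ℝ} (hε : 0 < ε) :
    ∀ᶠ x in atTop, |h x| ≤ ε * x := by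
  have hone := (hlim 1).abs.eventually
    (gt_mem_nhds (by simpa using half_pos hε : |(0 : ℝ)| < ε / 2))
  obtain ⟨X, hX⟩ := eventually_atTop.1
    ((eventually_forall_abs_add_sub_le_two hm hlim).and (hone.and (eventually_ge_atTop 0)))
  have hX0 : 0 ≤ X := (hX X le_rfl).2.2
  have hstep : ∀ (n : ℕ) (x : ℝ), X ≤ x → |h (x + n)| ≤ |h x| + n * (ε / 2) := by
    intro n x hx
    induction n with
    | zero => simp
    | succ n ih =>
      have h1 := (hX (x + n) (by linarith [n.cast_nonneg (α := ℝ)])).2.1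
      rw [add_assoc] at h1
      have h2 := abs_sub_abs_le_abs_sub (h (x + (n + 1))) (h (x + n))
      push_cast
      linarith
  filter_upwards [eventually_ge_atTop X, eventually_ge_atTop (2 * (|h X| + 2) / ε)] with x hx hx'
  have hn := Nat.floor_le (sub_nonneg.2 hx)
  have hn' := Nat.lt_floor_add_one (x - X)
  set n := ⌊x - X⌋₊
  have h1 := hstep n (x - n) (by linarith)
  have h2 := (hX X le_rfl).1 (x - n - X) ⟨by linarith, by linarith⟩
  rw [show X + (x - n - X) = x - n by ring] at h2
  have h3 := abs_sub_abs_le_abs_sub (h (x - n)) (h X)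
  rw [sub_add_cancel] at h1
  rw [div_le_iff₀ hε] at hx'
  nlinarith

/-- A slowly varying function is eventually squeezed between arbitrarily small powers. -/
lemma eventually_rpow_neg_le_and_le_rpow_of_slowlyVarying {L : ℝ → ℝ} (hLmeas : Measurable L)
    (hLpos : ∀ x > 0, 0 < L x)
    (hSV : ∀ t > 0, Tendsto (fun u : ℝ => L (u * t) / L u) atTop (nhds 1))
    {ε : ℝ} (hε : 0 < ε) :
    ∀ᶠ r : ℝ in atTop, r ^ (-ε) ≤ L r ∧ L r ≤ r ^ ε := by
  have hmeas : Measurable fun x => Real.log (L (Real.exp x)) := by fun_prop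
  have hlim : ∀ u, Tendsto (fun x => Real.log (L (Real.exp (x + u))) - Real.log (L (Real.exp x)))
      atTop (nhds 0) := by
    intro u
    have h1 := ((hSV (Real.exp u) (Real.exp_pos u)).comp Real.tendsto_exp_atTop).log one_ne_zero
    rw [Real.log_one] at h1
    refine h1.congr fun x => ?_
    rw [Function.comp_apply, ← Real.exp_add, Real.log_div (hLpos _ (Real.exp_pos _)).ne'
      (hLpos _ (Real.exp_pos _)).ne']
  have hbd := eventually_abs_le_mul_of_tendsto_add_sub hmeas hlim hε
  filter_upwards [Real.tendsto_log_atTop.eventually hbd, eventually_gt_atTop 0] with r hr hr0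
  rw [Real.exp_log hr0, abs_le] at hr
  rw [Real.rpow_def_of_pos hr0, Real.rpow_def_of_pos hr0, ← Real.le_log_iff_exp_le (hLpos r hr0),
    ← Real.log_le_iff_le_exp (hLpos r hr0)]
  constructor <;> linarith [hr.1, hr.2]

/-- If `L u ≤ u ^ α` and `L` is eventually dominated by every positive power, then
`u ^ (-3α) * L u ^ 3` is dominated by `u ^ (-γ)` on the whole half-line, for `γ < 3α`. -/
lemma exists_rpow_mul_cube_le_mul_rpow {L : ℝ → ℝ} {α γ : ℝ} (hγ0 : 0 < γ) (hγ : γ < 3 * α)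
    (hLpos : ∀ x > 0, 0 < L x) (hLle : ∀ u > (0 : ℝ), L u ≤ u ^ α)
    (hgrowth : ∀ ε > (0 : ℝ), ∀ᶠ u : ℝ in atTop, L u ≤ u ^ ε) :
    ∃ A > (0 : ℝ), ∀ u > (0 : ℝ), u ^ (-(3 * α)) * L u ^ 3 ≤ A * u ^ (-γ) := by
  obtain ⟨U, hU⟩ := eventually_atTop.1
    ((hgrowth ((3 * α - γ) / 3) (by linarith)).and (eventually_ge_atTop 1))
  have hU1 : 1 ≤ U := (hU U le_rfl).2
  have hcube : ∀ u > 0, ∀ s : ℝ, L u ≤ u ^ s →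
      u ^ (-(3 * α)) * L u ^ 3 ≤ u ^ (-(3 * α) + s * 3) := by
    intro u hu s hs
    rw [Real.rpow_add hu, Real.rpow_mul hu.le]
    have := pow_le_pow_left₀ (hLpos u hu).le hs 3
    gcongr
    exact_mod_cast this
  refine ⟨U ^ γ, by positivity, fun u hu => ?_⟩
  rcases le_total U u with h | h
  · have h1 := hcube u hu _ (hU u h).1
    rw [show -(3 * α) + (3 * α - γ) / 3 * 3 = -γ by ring] at h1
    exact h1.trans (le_mul_of_one_le_left (by positivity) (Real.one_le_rpow hU1 hγ0.le))
  · have h1 := hcube u hu _ (hLle u hu)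
    rw [show -(3 * α) + α * 3 = 0 by ring, Real.rpow_zero] at h1
    refine h1.trans ?_
    rw [Real.rpow_neg hu.le, ← div_eq_mul_inv, one_le_div (by positivity)]
    exact Real.rpow_le_rpow hu.le h hγ0.le

/-- Scaling of the integral of a locally integrable power of the norm over balls. -/
lemma lintegral_ball_norm_rpow_neg {d : ℕ} (hd : 1 ≤ d) {γ : ℝ} (hγ : γ < d) (ρ : ℝ) {r : ℝ}
    (hr : 0 < r) :
    ∫⁻ z in Metric.ball (0 : EuclideanSpace ℝ (Fin d)) (r * ρ), ENNReal.ofReal (‖z‖ ^ (-γ))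
      = ENNReal.ofReal (r ^ ((d : ℝ) - γ)
          * ∫ z in Metric.ball (0 : EuclideanSpace ℝ (Fin d)) ρ, ‖z‖ ^ (-γ)) := by
  have hmeas : Measurable fun z : EuclideanSpace ℝ (Fin d) => ‖z‖ ^ (-γ) := by fun_prop
  rw [← ofReal_integral_eq_lintegral_ofReal]
  · have h1 := Measure.setIntegral_comp_smul_of_pos volume
      (fun z : EuclideanSpace ℝ (Fin d) => ‖z‖ ^ (-γ)) (Metric.ball 0 ρ) hr
    simp only [norm_smul, Real.norm_eq_abs, abs_of_pos hr, smul_eq_mul,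
      finrank_euclideanSpace_fin, smul_ball hr.ne', smul_zero,
      Real.mul_rpow hr.le (norm_nonneg _), integral_const_mul] at h1
    rw [eq_inv_mul_iff_mul_eq₀ (by positivity), ← Real.rpow_natCast, ← mul_assoc,
      ← Real.rpow_add hr, ← sub_eq_add_neg] at h1
    rw [h1]
  · refine integrableOn_ball_of_norm_le_rpow (C := 1) (α := γ) (by simpa using hd)
      (by simpa using hγ) (ae_of_all _ fun z => ?_) hmeas.aestronglyMeasurable
    rw [Real.norm_of_nonneg (by positivity), one_mul]
  · exact ae_of_all _ fun z => by positivity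

/-- A double integral over a ball of a function of `x - y` is controlled by the integral of a
majorant over the ball of twice the radius. -/
lemma lintegral_ball_lintegral_ball_sub_le {d : ℕ} (hd : 1 ≤ d)
    {F G : EuclideanSpace ℝ (Fin d) → ℝ≥0∞} (hFG : ∀ z ≠ 0, F z ≤ G z) (R : ℝ) :
    ∫⁻ x in Metric.ball (0 : EuclideanSpace ℝ (Fin d)) R,
        ∫⁻ y in Metric.ball (0 : EuclideanSpace ℝ (Fin d)) R, F (x - y)
      ≤ (∫⁻ z in Metric.ball (0 : EuclideanSpace ℝ (Fin d)) (2 * R), G z)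
          * volume (Metric.ball (0 : EuclideanSpace ℝ (Fin d)) R) := by
  have : Nonempty (Fin d) := ⟨⟨0, hd⟩⟩
  have hinner : ∀ x ∈ Metric.ball (0 : EuclideanSpace ℝ (Fin d)) R,
      ∫⁻ y in Metric.ball (0 : EuclideanSpace ℝ (Fin d)) R, F (x - y)
        ≤ ∫⁻ z in Metric.ball (0 : EuclideanSpace ℝ (Fin d)) (2 * R), G z := by
    intro x hx
    rw [← lintegral_indicator measurableSet_ball, ← lintegral_indicator measurableSet_ball,
      ← lintegral_sub_left_eq_self
        ((Metric.ball (0 : EuclideanSpace ℝ (Fin d)) (2 * R)).indicator G) x]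
    refine lintegral_mono_ae ?_
    filter_upwards [Measure.ae_ne volume x] with y hy
    by_cases hyR : y ∈ Metric.ball (0 : EuclideanSpace ℝ (Fin d)) R
    · have hmem : x - y ∈ Metric.ball (0 : EuclideanSpace ℝ (Fin d)) (2 * R) := by
        rw [mem_ball_zero_iff] at *
        linarith [norm_sub_le x y]
      rw [Set.indicator_of_mem hyR, Set.indicator_of_mem hmem]
      exact hFG _ (sub_ne_zero.2 hy.symm)
    · rw [Set.indicator_of_notMem hyR]
      exact zero_le
  rw [← setLIntegral_const]
  exact setLIntegral_mono measurable_const hinner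

/-- For `0 < α < d/2`, a bounded convex `Δ ⊂ ℝ^d` of positive measure with
the origin in its interior, and a measurable, locally bounded, slowly varying `L` with
`L(u) ≤ u^α`, for every `δ > 0` there are `C > 0`, `r₀ > 0` with, for all `r ≥ r₀`,
`∫_{Δ(r)} ∫_{Δ(r)} ‖x-y‖^{-3α} L(‖x-y‖)³ dx dy
   ≤ C r^{2(d-α)} L(r)² r^{-α(d-2α)/(d-α)+δ}`, where `Δ(r) = r • Δ`. -/
theorem variance_remainder_integral_bound
    (d : ℕ) (hd : 1 ≤ d) (α : ℝ) (hα : 0 < α) (hαd : α < d / 2)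
    (Δ : Set (EuclideanSpace ℝ (Fin d)))
    (hΔbdd : Bornology.IsBounded Δ) (hΔconv : Convex ℝ Δ)
    (hΔvol : 0 < volume Δ) (hΔ0 : 0 ∈ interior Δ)
    (L : ℝ → ℝ) (hLmeas : Measurable L) (hLpos : ∀ x > 0, 0 < L x)
    (hLlocbdd : ∀ K : Set ℝ, IsCompact K → K ⊆ Set.Ioi 0 → ∃ M, ∀ x ∈ K, L x ≤ M)
    (hSV : ∀ t > 0, Tendsto (fun u : ℝ => L (u * t) / L u) atTop (nhds 1))
    (hLle : ∀ u > (0 : ℝ), L u ≤ u ^ α)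
    (δ : ℝ) (hδ : 0 < δ) :
    ∃ C > (0 : ℝ), ∃ r₀ > (0 : ℝ), ∀ r ≥ r₀,
      ∫⁻ x in r • Δ, ∫⁻ y in r • Δ,
          (‖x - y‖₊ : ℝ≥0∞) ^ (-(3 * α)) * ENNReal.ofReal (L ‖x - y‖ ^ 3)
        ≤ ENNReal.ofReal (C * r ^ (2 * ((d : ℝ) - α)) * L r ^ 2
            * r ^ (-(α * ((d : ℝ) - 2 * α) / ((d : ℝ) - α)) + δ)) := by
  have hdpos : (0 : ℝ) < d - α := by linarith
  set β : ℝ := α * ((d : ℝ) - 2 * α) / ((d : ℝ) - α) with hβ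
  have hβ0 : 0 < β := div_pos (mul_pos hα (by linarith)) hdpos
  have hβα : β < α := by
    rw [hβ, div_lt_iff₀ hdpos]
    exact mul_lt_mul_of_pos_left (by linarith) hα
  have hβd : 2 * α + β < d := by
    have : β < d - 2 * α := by
      rw [hβ, div_lt_iff₀ hdpos, mul_comm]
      exact mul_lt_mul_of_pos_left (by linarith) (by linarith)
    linarith
  have hL := fun ε (hε : 0 < ε) =>
    eventually_rpow_neg_le_and_le_rpow_of_slowlyVarying hLmeas hLpos hSV hε
  obtain ⟨A, hA, hAle⟩ := exists_rpow_mul_cube_le_mul_rpow (γ := 2 * α + β) (by linarith)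
    (by linarith) hLpos hLle fun ε hε => (hL ε hε).mono fun _ h => h.2
  obtain ⟨ρ, hρ, hΔρ⟩ := hΔbdd.exists_pos_norm_lt
  set K := ∫ z in Metric.ball (0 : EuclideanSpace ℝ (Fin d)) (2 * ρ), ‖z‖ ^ (-(2 * α + β))
  have hK : 0 ≤ K := integral_nonneg fun z => by positivity
  set V := (volume (Metric.ball (0 : EuclideanSpace ℝ (Fin d)) ρ)).toReal with hV
  obtain ⟨r₀, hr₀⟩ := eventually_atTop.1
    ((hL (δ / 2) (half_pos hδ)).and (eventually_gt_atTop 0))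
  refine ⟨A * K * V + 1, by positivity, r₀, (hr₀ r₀ le_rfl).2, fun r hr => ?_⟩
  obtain ⟨⟨hLr, -⟩, hr0⟩ := hr₀ r hr
  have hsub : r • Δ ⊆ Metric.ball 0 (r * ρ) := by
    rintro _ ⟨x, hx, rfl⟩
    rw [mem_ball_zero_iff, norm_smul, Real.norm_of_nonneg hr0.le]
    exact mul_lt_mul_of_pos_left (hΔρ x hx) hr0
  have hFG : ∀ z : EuclideanSpace ℝ (Fin d), z ≠ 0 →
      (‖z‖₊ : ℝ≥0∞) ^ (-(3 * α)) * ENNReal.ofReal (L ‖z‖ ^ 3)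
        ≤ ENNReal.ofReal A * ENNReal.ofReal (‖z‖ ^ (-(2 * α + β))) := by
    intro z hz
    have hz' := norm_pos_iff.2 hz
    rw [← enorm_eq_nnnorm, ← ofReal_norm, ENNReal.ofReal_rpow_of_pos hz',
      ← ENNReal.ofReal_mul (by positivity), ← ENNReal.ofReal_mul hA.le]
    exact ENNReal.ofReal_le_ofReal (hAle _ hz')
  have hvol : volume (Metric.ball (0 : EuclideanSpace ℝ (Fin d)) (r * ρ))
      = ENNReal.ofReal (r ^ (d : ℝ) * V) := by
    have h1 := Measure.addHaar_smul_of_nonneg volume hr0.le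
      (Metric.ball (0 : EuclideanSpace ℝ (Fin d)) ρ)
    rw [smul_ball hr0.ne', smul_zero, Real.norm_of_nonneg hr0.le,
      finrank_euclideanSpace_fin] at h1
    rw [h1, ENNReal.ofReal_mul (by positivity), hV, ENNReal.ofReal_toReal measure_ball_lt_top.ne,
      Real.rpow_natCast]
  have hLr2 : 1 ≤ L r ^ 2 * r ^ δ := by
    have h1 := pow_le_pow_left₀ (by positivity) hLr 2
    rw [← Real.rpow_natCast (r ^ _), ← Real.rpow_mul hr0.le] at h1
    calc (1 : ℝ) = r ^ (-(δ / 2) * (2 : ℕ)) * r ^ δ := by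
          rw [← Real.rpow_add hr0]
          simp
      _ ≤ _ := by gcongr
  calc _ ≤ ∫⁻ x in Metric.ball 0 (r * ρ), ∫⁻ y in r • Δ,
          (‖x - y‖₊ : ℝ≥0∞) ^ (-(3 * α)) * ENNReal.ofReal (L ‖x - y‖ ^ 3) :=
        lintegral_mono_set hsub
    _ ≤ ∫⁻ x in Metric.ball 0 (r * ρ), ∫⁻ y in Metric.ball 0 (r * ρ),
          (‖x - y‖₊ : ℝ≥0∞) ^ (-(3 * α)) * ENNReal.ofReal (L ‖x - y‖ ^ 3) :=
        lintegral_mono fun x => lintegral_mono_set hsub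
    _ ≤ _ := lintegral_ball_lintegral_ball_sub_le hd hFG (r * ρ)
    _ = ENNReal.ofReal (A * (r ^ ((d : ℝ) - (2 * α + β)) * K) * (r ^ (d : ℝ) * V)) := by
        rw [lintegral_const_mul' _ _ ENNReal.ofReal_ne_top, mul_left_comm 2 r ρ,
          lintegral_ball_norm_rpow_neg hd hβd _ hr0, hvol, ← ENNReal.ofReal_mul hA.le,
          ← ENNReal.ofReal_mul (by positivity)]
    _ ≤ _ := by
        refine ENNReal.ofReal_le_ofReal ?_
        calc _ = A * K * V * r ^ (2 * ((d : ℝ) - α) + -β) := by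
              rw [show 2 * ((d : ℝ) - α) + -β = (d - (2 * α + β)) + d by ring,
                Real.rpow_add hr0 (d - (2 * α + β)) d]
              ring
          _ ≤ (A * K * V + 1) * r ^ (2 * ((d : ℝ) - α) + -β) * (L r ^ 2 * r ^ δ) := by
              refine (mul_le_mul_of_nonneg_right (le_add_of_nonneg_right zero_le_one)
                (by positivity)).trans (le_mul_of_one_le_right (by positivity) hLr2)
          _ = _ := by
              rw [Real.rpow_add hr0 _ (-β), Real.rpow_add hr0 (-β)]
              ring
end

section
/- Let q > 0 and let L : (0,∞) → (0,∞) be measurable, locally bounded on (0,∞), slowly varying at infinity, and suppose there exist C₀ > 0 and r₁ > 0 such that |1 − L(t·r)/L(r)| ≤ C₀ / r^q for all t ≥ 1 and r ≥ r₁. Then for every β > 0 and every γ ∈ (0,1) there exist constants C > 0 and r₀ > 0 such that for all r ≥ r₀ and all t with 1 ≤ t ≤ r^γ, |1 − L(r/t)/L(r)| ≤ C · t^{q+β} / r^q. -/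
open Filter

/-- If `L` is measurable, locally bounded on `(0,∞)`, positive, slowly varying
at infinity, and satisfies `|1 - L(t r)/L r| ≤ C₀ / r^q` for `t ≥ 1`, `r ≥ r₁`, then for
every `β > 0` and `γ ∈ (0,1)` there are `C > 0`, `r₀ > 0` with
`|1 - L(r/t)/L r| ≤ C t^{q+β} / r^q` for all `r ≥ r₀` and `1 ≤ t ≤ r^γ`. -/
theorem slowly_varying_downscale_bound
    (q : ℝ) (hq : 0 < q) (L : ℝ → ℝ)
    (hLmeas : Measurable L) (hLpos : ∀ x > 0, 0 < L x)
    (hLlocbdd : ∀ K : Set ℝ, IsCompact K → K ⊆ Set.Ioi 0 → ∃ M, ∀ x ∈ K, L x ≤ M)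
    (hSV : ∀ t > 0, Tendsto (fun u : ℝ => L (u * t) / L u) atTop (nhds 1))
    (C₀ r₁ : ℝ) (hC₀ : 0 < C₀) (hr₁ : 0 < r₁)
    (hrem : ∀ t ≥ (1 : ℝ), ∀ r ≥ r₁, |1 - L (t * r) / L r| ≤ C₀ / r ^ q) :
    ∀ β > (0 : ℝ), ∀ γ ∈ Set.Ioo (0 : ℝ) 1,
      ∃ C > (0 : ℝ), ∃ r₀ > (0 : ℝ), ∀ r ≥ r₀, ∀ t, 1 ≤ t → t ≤ r ^ γ →
        |1 - L (r / t) / L r| ≤ C * t ^ (q + β) / r ^ q := by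
  intro β hβ γ hγ
  have hpow : Tendsto (fun r : ℝ => r ^ (1 - γ)) atTop atTop :=
    tendsto_rpow_atTop (by linarith [hγ.2])
  have hqpow : Tendsto (fun s : ℝ => s ^ q) atTop atTop := tendsto_rpow_atTop hq
  obtain ⟨s₀, hs₀⟩ := eventually_atTop.1
    ((hqpow.eventually_ge_atTop (2 * C₀)).and (eventually_ge_atTop r₁))
  obtain ⟨r₀, hr₀⟩ := eventually_atTop.1 (hpow.eventually_ge_atTop s₀)
  refine ⟨2 * C₀, by positivity, max r₀ 1, by positivity, fun r hr t ht htr => ?_⟩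
  have hrpos : 0 < r := lt_of_lt_of_le one_pos ((le_max_right _ _).trans hr)
  have htpos : 0 < t := one_pos.trans_le ht
  have hle : r ^ (1 - γ) ≤ r / t := by
    rw [le_div_iff₀ htpos]
    calc r ^ (1 - γ) * t ≤ r ^ (1 - γ) * r ^ γ := by gcongr
      _ = r := by rw [← Real.rpow_add hrpos]; simp
  obtain ⟨hsq, hsr⟩ := hs₀ (r / t) ((hr₀ r ((le_max_left _ _).trans hr)).trans hle)
  have hspos : 0 < r / t := by positivity
  have hrem' := hrem t ht (r / t) hsr
  rw [mul_div_cancel₀ r htpos.ne'] at hrem'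
  have hhalf : C₀ / (r / t) ^ q ≤ 1 / 2 := by
    rw [div_le_div_iff₀ (by positivity) two_pos]
    linarith
  have hratio : 1 / 2 ≤ L r / L (r / t) := by
    linarith [(abs_le.1 hrem').2]
  have hLr := hLpos r hrpos
  have hLs := hLpos _ hspos
  have hinv : L (r / t) / L r ≤ 2 := by
    rw [div_le_div_iff₀ two_pos hLs] at hratio
    rw [div_le_iff₀ hLr]
    linarith
  have hid : 1 - L (r / t) / L r = -((1 - L r / L (r / t)) * (L (r / t) / L r)) := by
    field_simp
    ring
  rw [hid, abs_neg, abs_mul, abs_of_pos (div_pos hLs hLr)]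
  calc |1 - L r / L (r / t)| * (L (r / t) / L r) ≤ C₀ / (r / t) ^ q * 2 := by gcongr
    _ = 2 * C₀ * t ^ q / r ^ q := by
      rw [Real.div_rpow hrpos.le htpos.le]
      field_simp
    _ ≤ 2 * C₀ * t ^ (q + β) / r ^ q := by
      gcongr
      linarith
end
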